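/- Let G be a finite simple undirected graph, (w1, w2) an edge of G, and G' the graph obtained from G by deleting the edge (w1, w2). Let v be a node and r ≥ 0 an integer. If in G there is no path of length at most r from v to w1, or there is no path of length at most r from v to w2, then the ball B_{G'}[v, r] equals the ball B_{G}[v, r], i.e., they have the same node set and the same edge set. -/

import Mathlib

/-- The set of nodes reachable from `v` in `G` by a path of length at most `r`
(equivalently, at hop-distance at most `r` from `v`). -/
def ballVerts {V : Type} (G : SimpleGraph V) (v : V) (r : ℕ) : Set V :=
  {w | ∃ p : G.Walk v w, p.length ≤ r}

/-- If every edge of `G` between nodes of the walk `p` is an edge of `H`, then `H` has a walk with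
the same endpoints and length as `p`. -/
theorem exists_walk_length_eq_of_adj_on_support {V : Type*} {G H : SimpleGraph V} {u w : V}
    (p : G.Walk u w)
    (h : ∀ a ∈ p.support, ∀ b ∈ p.support, G.Adj a b → H.Adj a b) :
    ∃ q : H.Walk u w, q.length = p.length := by
  have hp : ∀ e ∈ p.edges, e ∈ H.edgeSet := by
    intro e he
    induction e using Sym2.ind with
    | _ a b =>
      exact h a (p.fst_mem_support_of_mem_edges he) b (p.snd_mem_support_of_mem_edges he)
        (p.adj_of_mem_edges he)
  exact ⟨p.transfer H hp, p.length_transfer hp⟩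

/-- Every node visited by a walk of length at most `r` from `v` lies in the ball around `v`. -/
theorem mem_ballVerts_of_mem_support {V : Type} {G : SimpleGraph V} {v w x : V} {r : ℕ}
    (p : G.Walk v w) (hp : p.length ≤ r) (hx : x ∈ p.support) : x ∈ ballVerts G v r := by
  classical
  exact ⟨p.takeUntil x hx, (p.length_takeUntil_le_length hx).trans hp⟩

/-- let `G'` be obtained from the finite simple graph `G` by
deleting the edge `(w1, w2)`. If in `G` there is no path of length at most `r`
from `v` to `w1`, or none from `v` to `w2`, then the balls `B_{G'}[v, r]` and
`B_G[v, r]` have the same node set and the same edge set. -/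
theorem ball_unaffected_edge_deletion {V : Type} [Fintype V]
    (G G' : SimpleGraph V) (w1 w2 v : V) (r : ℕ)
    (hadj : G.Adj w1 w2)
    (hG' : ∀ a b, G'.Adj a b ↔
      G.Adj a b ∧ ¬((a = w1 ∧ b = w2) ∨ (a = w2 ∧ b = w1)))
    (hfar : w1 ∉ ballVerts G v r ∨ w2 ∉ ballVerts G v r) :
    ballVerts G' v r = ballVerts G v r ∧
    (∀ a b, (a ∈ ballVerts G' v r ∧ b ∈ ballVerts G' v r ∧ G'.Adj a b) ↔
      (a ∈ ballVerts G v r ∧ b ∈ ballVerts G v r ∧ G.Adj a b)) := by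
  have hle : G' ≤ G := fun a b hab => ((hG' a b).1 hab).1
  have hball : ∀ a ∈ ballVerts G v r, ∀ b ∈ ballVerts G v r, G.Adj a b → G'.Adj a b := by
    intro a ha b hb hab
    refine (hG' a b).2 ⟨hab, ?_⟩
    rintro (⟨rfl, rfl⟩ | ⟨rfl, rfl⟩) <;> tauto
  have hverts : ballVerts G' v r = ballVerts G v r := by
    ext w
    constructor
    · rintro ⟨p, hp⟩
      exact ⟨p.mapLe hle, by simpa using hp⟩
    · rintro ⟨p, hp⟩
      obtain ⟨q, hq⟩ := exists_walk_length_eq_of_adj_on_support p fun a ha b hb =>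
        hball a (mem_ballVerts_of_mem_support p hp ha) b (mem_ballVerts_of_mem_support p hp hb)
      exact ⟨q, hq.trans_le hp⟩
  refine ⟨hverts, fun a b => ?_⟩
  rw [hverts]
  exact ⟨fun ⟨ha, hb, hab⟩ => ⟨ha, hb, hle hab⟩,
    fun ⟨ha, hb, hab⟩ => ⟨ha, hb, hball a ha b hb hab⟩⟩
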